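/- arXiv:2509.03742 — 4 statements merged into one kernel-verified Lean document; each statement's English description precedes it below -/
import Mathlib

section
/- Let g be a positive integer and let P := {M ∈ Sp_{2g}(ℤ) : the upper-right g×g block of M is 0}. Then P is a subgroup of Sp_{2g}(ℤ); the map ul : P → GL_g(ℤ) sending a matrix M to its upper-left g×g block is a well-defined surjective group homomorphism; and the kernel of ul is exactly the set of matrices fromBlocks 1 0 C 1 with C a symmetric g×g integer matrix. Equivalently, there is a short exact sequence 1 → SymMat_g(ℤ) → P → GL_g(ℤ) → 1, where SymMat_g(ℤ) is the additive group of symmetric g×g integer matrices. -/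
open Matrix

namespace SymplecticGroup

variable {l R : Type*} [Fintype l] [CommRing R]

theorem toBlocks₁₁_mul (M N : Matrix (l ⊕ l) (l ⊕ l) R) :
    (M * N).toBlocks₁₁ = M.toBlocks₁₁ * N.toBlocks₁₁ + M.toBlocks₁₂ * N.toBlocks₂₁ := by
  conv_lhs => rw [← fromBlocks_toBlocks M, ← fromBlocks_toBlocks N, fromBlocks_multiply]
  exact toBlocks_fromBlocks₁₁ ..

theorem toBlocks₁₂_mul (M N : Matrix (l ⊕ l) (l ⊕ l) R) :
    (M * N).toBlocks₁₂ = M.toBlocks₁₁ * N.toBlocks₁₂ + M.toBlocks₁₂ * N.toBlocks₂₂ := by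
  conv_lhs => rw [← fromBlocks_toBlocks M, ← fromBlocks_toBlocks N, fromBlocks_multiply]
  exact toBlocks_fromBlocks₁₂ ..

variable [DecidableEq l]

theorem toBlocks₁₂_inv (M : symplecticGroup l R) :
    (M⁻¹).1.toBlocks₁₂ = -M.1.toBlocks₁₂ᵀ := by
  rw [coe_inv, ← fromBlocks_toBlocks M.1]
  simp [J, fromBlocks_transpose, fromBlocks_multiply, fromBlocks_neg]

variable (l R)

/-- The subgroup of symplectic matrices whose upper-right block vanishes. -/
def siegelParabolic : Subgroup (symplecticGroup l R) where
  carrier := {M | M.1.toBlocks₁₂ = 0}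
  mul_mem' {M N} hM hN := by
    simp only [Set.mem_ofPred_eq] at hM hN ⊢
    simp [toBlocks₁₂_mul, hM, hN]
  one_mem' := by
    simp [← fromBlocks_one]
  inv_mem' {M} hM := by
    simp only [Set.mem_ofPred_eq] at hM ⊢
    simp [toBlocks₁₂_inv, hM]

variable {l R}

theorem mem_siegelParabolic {M : symplecticGroup l R} :
    M ∈ siegelParabolic l R ↔ M.1.toBlocks₁₂ = 0 := Iff.rfl

variable (l R) in
/-- The upper-left block, as a homomorphism to the matrix monoid. -/
def upperLeftBlock : siegelParabolic l R →* Matrix l l R where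
  toFun M := M.1.1.toBlocks₁₁
  map_one' := by simp [← fromBlocks_one]
  map_mul' M N := by simp [toBlocks₁₁_mul, mem_siegelParabolic.1 M.2]

variable (l R) in
/-- The upper-left block, as a homomorphism to the general linear group. -/
def upperLeft : siegelParabolic l R →* GL l R :=
  (upperLeftBlock l R).toHomUnits

theorem coe_upperLeft (M : siegelParabolic l R) :
    (upperLeft l R M : Matrix l l R) = M.1.1.toBlocks₁₁ := rfl

theorem upperLeft_surjective : Function.Surjective (upperLeft l R) := by
  intro A
  have h : fromBlocks A.1 0 0 (A⁻¹).1ᵀ ∈ symplecticGroup l R := by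
    rw [fromBlocks_mem_iff]
    simp [← transpose_mul, ← Units.val_mul, -coe_units_inv]
  exact ⟨⟨⟨_, h⟩, mem_siegelParabolic.2 (toBlocks_fromBlocks₁₂ ..)⟩,
    Units.ext (toBlocks_fromBlocks₁₁ ..)⟩

theorem mem_ker_upperLeft {M : siegelParabolic l R} :
    M ∈ (upperLeft l R).ker ↔ ∃ C : Matrix l l R, Cᵀ = C ∧ M.1.1 = fromBlocks 1 0 C 1 := by
  rw [MonoidHom.mem_ker, Units.ext_iff, coe_upperLeft, Units.val_one]
  constructor
  · intro hA
    have hB := mem_siegelParabolic.1 M.2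
    have hM := M.1.2
    rw [← fromBlocks_toBlocks M.1.1, hA, hB, fromBlocks_mem_iff] at hM
    obtain ⟨hC, -, hD⟩ := hM
    refine ⟨M.1.1.toBlocks₂₁, by simpa using hC.symm, ?_⟩
    have hD : M.1.1.toBlocks₂₂ = 1 := by simpa using hD
    conv_lhs => rw [← fromBlocks_toBlocks M.1.1, hA, hB, hD]
  · rintro ⟨C, -, hM⟩
    rw [hM, toBlocks_fromBlocks₁₁]

end SymplecticGroup

/-- The set `P` of symplectic integer matrices with zero upper-right block is a subgroup of
`Sp_{2g}(ℤ)`; the upper-left block map `ul : P → GL_g(ℤ)` is a well-defined surjective group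
homomorphism, and its kernel consists exactly of the matrices `fromBlocks 1 0 C 1` with `C`
symmetric.  This is the short exact sequence
`1 → SymMat_g(ℤ) → P → GL_g(ℤ) → 1` of Proposition 5.1. -/
theorem statement2 (g : ℕ) (hg : 0 < g) :
    ∃ P : Subgroup (Matrix.symplecticGroup (Fin g) ℤ),
      (∀ M : Matrix.symplecticGroup (Fin g) ℤ,
          M ∈ P ↔ (M.1 : Matrix (Fin g ⊕ Fin g) (Fin g ⊕ Fin g) ℤ).toBlocks₁₂ = 0) ∧
      ∃ ul : P →* GL (Fin g) ℤ,
        Function.Surjective ul ∧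
        (∀ M : P, (ul M : Matrix (Fin g) (Fin g) ℤ) = (M.1.1).toBlocks₁₁) ∧
        (∀ M : P, M ∈ ul.ker ↔
          ∃ C : Matrix (Fin g) (Fin g) ℤ, Cᵀ = C ∧ M.1.1 = fromBlocks 1 0 C 1) := by
  exact ⟨SymplecticGroup.siegelParabolic (Fin g) ℤ, fun _ => SymplecticGroup.mem_siegelParabolic,
    SymplecticGroup.upperLeft (Fin g) ℤ, SymplecticGroup.upperLeft_surjective,
    SymplecticGroup.coe_upperLeft, fun _ => SymplecticGroup.mem_ker_upperLeft⟩
end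

section
/- Let g be a positive integer. The map s : GL_g(ℤ) → Sp_{2g}(ℤ) sending A to fromBlocks A 0 0 (A⁻¹)ᵀ is an injective group homomorphism; each s(A) has zero upper-right g×g block and upper-left g×g block equal to A, so s takes values in the subgroup P = {M ∈ Sp_{2g}(ℤ) : upper-right block of M is 0} and satisfies ul ∘ s = id, where ul : P → GL_g(ℤ) sends M to its upper-left block. In particular the short exact sequence 1 → SymMat_g(ℤ) → P → GL_g(ℤ) → 1 of Proposition 5.1 splits. -/
open Matrix

namespace SymplecticGroup

variable {l R : Type*} [DecidableEq l] [Fintype l] [CommRing R]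

theorem fromBlocks_transpose_inv_mem (A : GL l R) :
    fromBlocks (A : Matrix l l R) 0 0 (↑(A⁻¹) : Matrix l l R)ᵀ ∈ symplecticGroup l R := by
  have h : (A : Matrix l l R) * (↑(A⁻¹) : Matrix l l R) = 1 := A.mul_inv
  have h' : (↑(A⁻¹) : Matrix l l R)ᵀ * (A : Matrix l l R)ᵀ = 1 := by
    rw [← transpose_mul, h, transpose_one]
  rw [mem_iff, J, fromBlocks_transpose, fromBlocks_multiply, fromBlocks_multiply]
  simp only [transpose_zero, transpose_transpose, Matrix.mul_zero, Matrix.zero_mul,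
    Matrix.mul_one, Matrix.mul_neg, Matrix.neg_mul, add_zero, zero_add, neg_zero, h, h']

/-- The embedding `A ↦ fromBlocks A 0 0 (A⁻¹)ᵀ` of the general linear group into the symplectic
group. -/
def ofGL : GL l R →* symplecticGroup l R where
  toFun A := ⟨_, fromBlocks_transpose_inv_mem A⟩
  map_one' := Subtype.ext <| by simp
  map_mul' A B := Subtype.ext <| by
    simp only [_root_.mul_inv_rev, Units.val_mul, transpose_mul, Submonoid.coe_mul,
      fromBlocks_multiply, Matrix.mul_zero, Matrix.zero_mul, add_zero, zero_add]

theorem coe_ofGL (A : GL l R) :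
    (ofGL A : Matrix (l ⊕ l) (l ⊕ l) R) =
      fromBlocks (A : Matrix l l R) 0 0 (↑(A⁻¹) : Matrix l l R)ᵀ :=
  rfl

theorem toBlocks₁₁_ofGL (A : GL l R) :
    (ofGL A : Matrix (l ⊕ l) (l ⊕ l) R).toBlocks₁₁ = A := by
  rw [coe_ofGL, toBlocks_fromBlocks₁₁]

theorem toBlocks₁₂_ofGL (A : GL l R) :
    (ofGL A : Matrix (l ⊕ l) (l ⊕ l) R).toBlocks₁₂ = 0 := by
  rw [coe_ofGL, toBlocks_fromBlocks₁₂]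

theorem ofGL_injective : Function.Injective (ofGL : GL l R →* symplecticGroup l R) :=
  fun A B h => Units.ext <| by rw [← toBlocks₁₁_ofGL A, h, toBlocks₁₁_ofGL]

end SymplecticGroup

/-- The map `A ↦ fromBlocks A 0 0 (A⁻¹)ᵀ` is an injective group homomorphism
`GL_g(ℤ) → Sp_{2g}(ℤ)` taking values among the symplectic matrices with zero upper-right
block and with upper-left block `A`; it splits the short exact sequence of Proposition 5.1. -/
theorem statement3 (g : ℕ) (hg : 0 < g) :
    ∃ s : GL (Fin g) ℤ →* Matrix.symplecticGroup (Fin g) ℤ,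
      Function.Injective s ∧
      (∀ A : GL (Fin g) ℤ,
        ((s A).1 : Matrix (Fin g ⊕ Fin g) (Fin g ⊕ Fin g) ℤ) =
          fromBlocks (A : Matrix (Fin g) (Fin g) ℤ) 0 0
            ((↑(A⁻¹) : Matrix (Fin g) (Fin g) ℤ))ᵀ) ∧
      (∀ A : GL (Fin g) ℤ,
        ((s A).1).toBlocks₁₂ = 0 ∧ ((s A).1).toBlocks₁₁ = (A : Matrix (Fin g) (Fin g) ℤ)) := by
  exact ⟨SymplecticGroup.ofGL, SymplecticGroup.ofGL_injective, SymplecticGroup.coe_ofGL,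
    fun A => ⟨SymplecticGroup.toBlocks₁₂_ofGL A, SymplecticGroup.toBlocks₁₁_ofGL A⟩⟩
end

section
/- Let g be a positive integer. For every x ∈ H = ℚ^{2g}, the contraction satisfies C₃(x ∧ ω) = (g − 1) · x. -/
open ExteriorAlgebra

/-- For every `x ∈ H = ℚ^{2g}`, the contraction satisfies `C₃(x ∧ ω) = (g − 1) • x`,
where `ω = Σᵢ eᵢ ∧ e_{g+i}` and `C₃` is the linear map on `⋀³ H` induced by the
alternating trilinear map `(x, y, z) ↦ ω(x,y)·z − ω(x,z)·y + ω(y,z)·x`. -/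
theorem statement8 (g : ℕ) (hg : 0 < g)
    (C₃ : ⋀[ℚ]^3 ((Fin g ⊕ Fin g) → ℚ) →ₗ[ℚ] ((Fin g ⊕ Fin g) → ℚ))
    (hC₃ : ∀ (u : ⋀[ℚ]^3 ((Fin g ⊕ Fin g) → ℚ)) (x y z : (Fin g ⊕ Fin g) → ℚ),
      (u : ExteriorAlgebra ℚ ((Fin g ⊕ Fin g) → ℚ)) = ExteriorAlgebra.ιMulti ℚ 3 ![x, y, z] →
      C₃ u =
        (∑ i : Fin g, (x (Sum.inl i) * y (Sum.inr i) - x (Sum.inr i) * y (Sum.inl i))) • z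
          - (∑ i : Fin g, (x (Sum.inl i) * z (Sum.inr i) - x (Sum.inr i) * z (Sum.inl i))) • y
          + (∑ i : Fin g, (y (Sum.inl i) * z (Sum.inr i) - y (Sum.inr i) * z (Sum.inl i))) • x) :
    ∀ (v : ⋀[ℚ]^3 ((Fin g ⊕ Fin g) → ℚ)) (x : (Fin g ⊕ Fin g) → ℚ),
      (v : ExteriorAlgebra ℚ ((Fin g ⊕ Fin g) → ℚ)) =
        ∑ i : Fin g, ExteriorAlgebra.ιMulti ℚ 3
          ![x, Pi.single (Sum.inl i) (1 : ℚ), Pi.single (Sum.inr i) (1 : ℚ)] →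
      C₃ v = ((g : ℚ) - 1) • x := by
  intro v x hv
  have hsum : v = ∑ i : Fin g, exteriorPower.ιMulti ℚ 3
      ![x, Pi.single (Sum.inl i) (1 : ℚ), Pi.single (Sum.inr i) (1 : ℚ)] := by
    apply Subtype.ext
    rw [hv, AddSubmonoidClass.coe_finsetSum]
    simp only [exteriorPower.ιMulti_apply_coe]
  have hterm (i : Fin g) : C₃ (exteriorPower.ιMulti ℚ 3
      ![x, Pi.single (Sum.inl i) (1 : ℚ), Pi.single (Sum.inr i) (1 : ℚ)]) =
      x - (Pi.single (Sum.inl i) (x (Sum.inl i)) + Pi.single (Sum.inr i) (x (Sum.inr i))) := by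
    rw [hC₃ _ _ _ _ (exteriorPower.ιMulti_apply_coe ℚ 3 _)]
    simp [Pi.single_apply, ← Pi.single_smul]
    abel
  have hx : ∑ i : Fin g, (Pi.single (Sum.inl i) (x (Sum.inl i)) +
      Pi.single (Sum.inr i) (x (Sum.inr i))) = x := by
    rw [Finset.sum_add_distrib, ← Fintype.sum_sum_type fun j => Pi.single j (x j),
      Finset.univ_sum_single]
  rw [hsum, map_sum, Finset.sum_congr rfl fun i _ => hterm i, Finset.sum_sub_distrib, hx,
    Finset.sum_const, Finset.card_univ, Fintype.card_fin, sub_smul, one_smul, Nat.cast_smul_eq_nsmul]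
end

section
/- Let g be a positive integer. Every M ∈ Sp_{2g}(ℤ) whose upper-right g×g block is zero factors uniquely as M = fromBlocks 1 0 C 1 · fromBlocks A 0 0 (A⁻¹)ᵀ with A ∈ GL_g(ℤ) and C a symmetric g×g integer matrix; explicitly, A is the upper-left g×g block of M and C is the lower-left g×g block of M multiplied on the right by A⁻¹. -/
open Matrix

/-- The relations between the blocks of a block lower triangular symplectic matrix. -/
theorem mul_transpose_eq_one_and_mul_transpose_comm {l R : Type*} [DecidableEq l] [Fintype l]
    [CommRing R] {P Q S : Matrix l l R} (h : fromBlocks P 0 Q S ∈ symplecticGroup l R) :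
    P * Sᵀ = 1 ∧ S * Qᵀ = Q * Sᵀ := by
  rw [SymplecticGroup.mem_iff] at h
  simp only [J, fromBlocks_transpose, fromBlocks_multiply, transpose_zero, Matrix.mul_zero,
    Matrix.zero_mul, Matrix.mul_neg, Matrix.neg_mul, Matrix.mul_one, add_zero, zero_add,
    fromBlocks_inj, neg_inj] at h
  exact ⟨h.2.1, add_neg_eq_zero.mp h.2.2.2⟩

/-- Every symplectic integer matrix `M` with zero upper-right block factors uniquely as
`M = fromBlocks 1 0 C 1 * fromBlocks A 0 0 (A⁻¹)ᵀ` with `A ∈ GL_g(ℤ)` and `C` symmetric;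
explicitly `A` is the upper-left block of `M` and `C` is the lower-left block of `M`
multiplied on the right by `A⁻¹`. -/
theorem statement10 (g : ℕ) (hg : 0 < g)
    (M : Matrix (Fin g ⊕ Fin g) (Fin g ⊕ Fin g) ℤ)
    (hM : M ∈ Matrix.symplecticGroup (Fin g) ℤ) (hblock : M.toBlocks₁₂ = 0) :
    ∃ (A : GL (Fin g) ℤ) (C : Matrix (Fin g) (Fin g) ℤ),
      Cᵀ = C ∧
      M = fromBlocks 1 0 C 1 *
            fromBlocks (A : Matrix (Fin g) (Fin g) ℤ) 0 0
              ((↑(A⁻¹) : Matrix (Fin g) (Fin g) ℤ))ᵀ ∧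
      (A : Matrix (Fin g) (Fin g) ℤ) = M.toBlocks₁₁ ∧
      C = M.toBlocks₂₁ * (↑(A⁻¹) : Matrix (Fin g) (Fin g) ℤ) ∧
      (∀ (A' : GL (Fin g) ℤ) (C' : Matrix (Fin g) (Fin g) ℤ), C'ᵀ = C' →
        M = fromBlocks 1 0 C' 1 *
              fromBlocks (A' : Matrix (Fin g) (Fin g) ℤ) 0 0
                ((↑(A'⁻¹) : Matrix (Fin g) (Fin g) ℤ))ᵀ →
        A' = A ∧ C' = C) := by
  obtain ⟨P, B, Q, S, rfl⟩ : ∃ P B Q S, M = fromBlocks P B Q S :=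
    ⟨_, _, _, _, (fromBlocks_toBlocks M).symm⟩
  obtain rfl : B = 0 := by simpa using hblock
  obtain ⟨hPS, hSQ⟩ := mul_transpose_eq_one_and_mul_transpose_comm hM
  have hSP : Sᵀ * P = 1 := mul_eq_one_comm.mp hPS
  refine ⟨⟨P, Sᵀ, hPS, hSP⟩, Q * Sᵀ, ?_, ?_, ?_, ?_, ?_⟩
  · rw [transpose_mul, transpose_transpose, hSQ]
  · simp [fromBlocks_multiply, Matrix.mul_assoc, hSP]
  · simp
  · simp
  · intro A' C' _ h
    simp only [fromBlocks_multiply, Matrix.one_mul, Matrix.mul_zero, Matrix.zero_mul, add_zero,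
      zero_add, fromBlocks_inj] at h
    obtain ⟨hP, -, hQ, -⟩ := h
    refine ⟨Units.ext hP.symm, ?_⟩
    rw [hQ, ← hP, Matrix.mul_assoc, hPS, Matrix.mul_one]
end
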